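/- Let p and r be distinct primes and q ∈ (0,1). Then P_q(pr) = ∑_{k=0}^{p} φ_q(k,p)^r + ∑_{k=0}^{r} φ_q(k,r)^p − q^{pr} − (1−q)^{pr}. -/

import Mathlib

open Finset

/-- The binomial probability mass function. -/
noncomputable def phi (q : ℝ) (k n : ℕ) : ℝ :=
  (n.choose k : ℝ) * q ^ k * (1 - q) ^ (n - k)

/-- The Bernoulli(q) probability weight of an outcome `c : Fin n → Bool`. -/
noncomputable def bernWeight (q : ℝ) (n : ℕ) (c : Fin n → Bool) : ℝ :=
  q ^ (Finset.univ.filter (fun j => c j = true)).card *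
    (1 - q) ^ (n - (Finset.univ.filter (fun j => c j = true)).card)

/-- Singularity probability of an `n × n` circulant Bernoulli(q) matrix (0/1 entries). -/
noncomputable def Pq (q : ℝ) (n : ℕ) : ℝ :=
  ∑ c : Fin n → Bool,
    if (Matrix.of fun i j : Fin n => (if c (j - i) then (1 : ℚ) else 0)).det = 0 then
      bernWeight q n c
    else 0
open Polynomial in
/-- shift operator -/
noncomputable def shiftOp {H : Type*} [AddCommGroup H] (g : H) : Module.End ℚ (H → ℚ) where
  toFun w := fun x => w (x + g)
  map_add' _ _ := rfl
  map_smul' _ _ := rfl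

theorem shiftOp_pow {H : Type*} [AddCommGroup H] (g : H) (k : ℕ) (w : H → ℚ) (x : H) :
    ((shiftOp g) ^ k) w x = w (x + k • g) := by
  induction k generalizing x with
  | zero => simp
  | succ k ih =>
    rw [pow_succ', Module.End.mul_apply]
    change ((shiftOp g) ^ k) w (x + g) = _
    rw [ih, succ_nsmul']; congr 1; abel

theorem shiftOp_poly {H ι : Type*} [AddCommGroup H] [Fintype ι] (g : H) (c : ι → ℚ) (ν : ι → ℕ)
    (w : H → ℚ) (x : H) :
    (Polynomial.aeval (shiftOp g) (∑ z, Polynomial.C (c z) * Polynomial.X ^ (ν z))) w x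
      = ∑ z, c z * w (x + ν z • g) := by
  rw [map_sum]
  simp [LinearMap.sum_apply, Finset.sum_apply, Module.algebraMap_end_apply, shiftOp_pow]

theorem const_of_shift {p : ℕ} (hp : p.Prime) {X : Type*} (u : ℕ) (hu : ¬ p ∣ u) (F : ZMod p → X)
    (h : ∀ a, F (a + u) = F a) (a b : ZMod p) : F a = F b := by
  have := Fact.mk hp
  have key : ∀ (k : ℕ) (a : ZMod p), F (a + k * u) = F a := by
    intro k
    induction k with
    | zero => simp
    | succ k ih =>
      intro a
      rw [← ih a, ← h (a + k * u)]; congr 1; push_cast; ring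
  have hu' : (u : ZMod p) ≠ 0 := by rwa [Ne, ZMod.natCast_eq_zero_iff]
  have := key ((b - a) / u).val a
  rw [ZMod.natCast_zmod_val, div_mul_cancel₀ _ hu'] at this
  rw [← this]; congr 1; ring

theorem rows_of_cyclotomic {p : ℕ} (hp : p.Prime) {ι : Type*} [Fintype ι] (c : ι → ℚ) (ν : ι → ℕ)
    (h : Polynomial.cyclotomic p ℚ ∣ ∑ z, Polynomial.C (c z) * Polynomial.X ^ (ν z))
    (a b : ZMod p) :
    ∑ z, (if (ν z : ZMod p) = a then c z else 0) = ∑ z, (if (ν z : ZMod p) = b then c z else 0) := by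
  have := Fact.mk hp
  refine const_of_shift hp 1 (by simpa using hp.one_lt.ne')
    (fun a => ∑ z, (if (ν z : ZMod p) = a then c z else 0)) ?_ a b
  intro a
  obtain ⟨g, hg⟩ := h
  have h1 : (Polynomial.X - 1) * (∑ z, Polynomial.C (c z) * Polynomial.X ^ (ν z)) =
      g * (Polynomial.X ^ p - 1) := by
    rw [hg, ← Polynomial.cyclotomic_prime_mul_X_sub_one ℚ p]; ring
  have h2 := congrArg (Polynomial.aeval (shiftOp (1 : ZMod p))) h1
  have hT : (shiftOp (1 : ZMod p)) ^ p = 1 := by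
    refine LinearMap.ext fun w => funext fun x => ?_
    simp [shiftOp_pow]
  rw [map_mul, map_mul, map_sub (Polynomial.aeval _) (_ ^ p), map_pow, Polynomial.aeval_X, hT, map_one, sub_self, mul_zero] at h2
  have h3 := congrFun (congrArg (fun L : Module.End ℚ (ZMod p → ℚ) => L (Pi.single 0 1)) h2) (-a-1)
  rw [map_sub, Polynomial.aeval_X, map_one, sub_mul, one_mul] at h3
  simp only [LinearMap.sub_apply, Pi.sub_apply, Module.End.mul_apply] at h3
  have h4 : ∀ (w : ZMod p → ℚ) x, shiftOp (1 : ZMod p) w x = w (x + 1) := fun _ _ => rfl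
  rw [h4, shiftOp_poly, shiftOp_poly] at h3
  simp only [LinearMap.zero_apply, Pi.zero_apply, Pi.single_apply] at h3
  have h5 := sub_eq_zero.1 h3
  simp only [Nat.cast_one]
  rw [← sub_eq_zero, ← neg_eq_zero, neg_sub, sub_eq_zero]
  convert h5 using 2 with z _ z _
  · simp only [nsmul_eq_mul, mul_one, mul_ite, mul_zero]
    refine if_congr ⟨fun h => by rw [h]; ring, fun h => by linear_combination h⟩ rfl rfl
  · simp only [nsmul_eq_mul, mul_one, mul_ite, mul_zero]
    refine if_congr ⟨fun h => by rw [h]; ring, fun h => by linear_combination h⟩ rfl rfl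

theorem X_pow_pr {p r : ℕ} (hp : p.Prime) (hr : r.Prime) (hpr : p ≠ r) :
    (Polynomial.X ^ (p * r) - 1 : Polynomial ℚ) =
      (Polynomial.X - 1) * Polynomial.cyclotomic p ℚ * Polynomial.cyclotomic r ℚ
        * Polynomial.cyclotomic (p * r) ℚ := by
  have := Fact.mk hp
  have := Fact.mk hr
  have h1 := Polynomial.cyclotomic_expand_eq_cyclotomic_mul hp (n := r)
    (by rw [Nat.prime_dvd_prime_iff_eq hp hr]; exact hpr) ℚ
  have h2 := Polynomial.cyclotomic_prime_mul_X_sub_one ℚ r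
  have h3 := Polynomial.cyclotomic_prime_mul_X_sub_one ℚ p
  have h4 := congrArg (Polynomial.expand ℚ p) h2
  rw [map_mul, h1] at h4
  simp only [map_sub, map_pow, Polynomial.expand_X, map_one] at h4
  rw [pow_mul, ← h4, ← h3, mul_comm r p]; ring

theorem aux_mixed {p r : ℕ} (hp : p.Prime) (hr : r.Prime) (hpr : p ≠ r)
    (c : ZMod p × ZMod r → ℚ)
    (h : ∀ x, c (x + (p + r) • (1 : ZMod p × ZMod r)) - c (x + p • 1) - c (x + r • 1) + c x = 0) :
    ∀ a a' b b', c (a, b) - c (a, b') = c (a', b) - c (a', b') := by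
  have e1 : ∀ a b, c (a + r, b + p) - c (a, b + p) - c (a + r, b) + c (a, b) = 0 := by
    intro a b
    have := h (a, b)
    simpa [Prod.ext_iff, Prod.mk_add_mk, nsmul_eq_mul, show (1 : ZMod p × ZMod r) = (1, 1) from rfl] using this
  have nd1 : ¬ r ∣ p := by rw [Nat.prime_dvd_prime_iff_eq hr hp]; exact hpr.symm
  have nd2 : ¬ p ∣ r := by rw [Nat.prime_dvd_prime_iff_eq hp hr]; exact hpr
  have e2 : ∀ a b b', c (a + r, b) - c (a, b) = c (a + r, b') - c (a, b') := fun a b b' =>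
    const_of_shift hr p nd1 (fun b => c (a + r, b) - c (a, b))
      (fun b => by linear_combination e1 a b) b b'
  intro a a' b b'
  exact const_of_shift hp r nd2 (fun a => c (a, b) - c (a, b'))
      (fun a => by linear_combination e2 a b b') a a'

theorem mixed_bool {α β : Type*} (d : α × β → Bool)
    (h : ∀ a a' b b', (if d (a, b) then (1:ℚ) else 0) - (if d (a, b') then (1:ℚ) else 0)
      = (if d (a', b) then (1:ℚ) else 0) - (if d (a', b') then (1:ℚ) else 0)) :
    (∀ a b b', d (a, b) = d (a, b')) ∨ (∀ a a' b, d (a, b) = d (a', b)) := by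
  by_contra! hcon
  obtain ⟨⟨a0, b0, b1, h0⟩, ⟨a1, a2, b2, h1⟩⟩ := hcon
  have k1 := h a0 a1 b0 b1
  have k2 := h a0 a2 b0 b1
  have k3 := h a1 a2 b0 b2
  revert k1 k2 k3 h0 h1
  cases d (a0, b0) <;> cases d (a0, b1) <;> cases d (a1, b0) <;> cases d (a1, b1) <;>
  cases d (a2, b0) <;> cases d (a2, b1) <;> cases d (a1, b2) <;> cases d (a2, b2) <;> norm_num

/-- weight -/
noncomputable def wt (q : ℝ) (b : Bool) : ℝ := if b then q else 1 - q

/-- count -/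
def cnt {β : Type*} [Fintype β] (e : β → Bool) : ℕ := (Finset.univ.filter (fun j => e j = true)).card

theorem prod_wt {β : Type*} [Fintype β] (q : ℝ) (e : β → Bool) :
    ∏ b, wt q (e b) = q ^ (cnt e) * (1 - q) ^ (Fintype.card β - cnt e) := by
  classical
  unfold wt cnt
  rw [Finset.prod_ite, Finset.prod_const, Finset.prod_const, Finset.filter_not, Finset.card_sdiff]
  simp [Finset.card_univ]

theorem cnt_le {β : Type*} [Fintype β] (e : β → Bool) : cnt e ≤ Fintype.card β :=
  Finset.card_le_univ _

theorem card_cnt (β : Type*) [Fintype β] [DecidableEq β] (k : ℕ) :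
    (Finset.univ.filter (fun e : β → Bool => cnt e = k)).card = (Fintype.card β).choose k := by
  rw [← Finset.card_univ, ← Finset.card_powersetCard]
  refine Finset.card_bij' (fun e _ => Finset.univ.filter (fun j => e j = true))
    (fun s _ => fun j => decide (j ∈ s)) ?_ ?_ ?_ ?_
  · intro e he
    rw [Finset.mem_powersetCard]
    exact ⟨Finset.subset_univ _, (Finset.mem_filter.1 he).2⟩
  · intro s hs
    rw [Finset.mem_filter]
    refine ⟨Finset.mem_univ _, ?_⟩
    simpa [cnt] using (Finset.mem_powersetCard.1 hs).2
  · intro e he; funext j; simp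
  · intro s hs; ext j; simp

theorem sum_cnt (β : Type*) [Fintype β] [DecidableEq β] (q : ℝ) (k : ℕ) :
    ∑ e : β → Bool, (if cnt e = k then ∏ b, wt q (e b) else 0) = phi q k (Fintype.card β) := by
  rw [← Finset.sum_filter]
  rw [Finset.sum_congr rfl (g := fun _ => q ^ k * (1 - q) ^ (Fintype.card β - k))]
  · rw [Finset.sum_const, card_cnt, nsmul_eq_mul, phi, mul_assoc]
  · intro e he
    rw [prod_wt, (Finset.mem_filter.1 he).2]

theorem sum_rows (α β : Type*) [Fintype α] [Fintype β] [Nonempty α] [DecidableEq α]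
    [DecidableEq β] (q : ℝ) (P : (α × β → Bool) → Prop) [DecidablePred P]
    (hP : ∀ d, P d ↔ ∀ a a', cnt (fun b => d (a, b)) = cnt (fun b => d (a', b))) :
    ∑ d : α × β → Bool, (if P d then ∏ x, wt q (d x) else 0)
      = ∑ k ∈ Finset.range (Fintype.card β + 1), phi q k (Fintype.card β) ^ (Fintype.card α) := by
  have h1 : ∀ k, phi q k (Fintype.card β) ^ (Fintype.card α) =
      ∑ d : α × β → Bool, (if ∀ a, cnt (fun b => d (a, b)) = k then ∏ x, wt q (d x) else 0) := by
    intro k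
    rw [← sum_cnt, ← Finset.card_univ, ← Finset.prod_const, Finset.prod_univ_sum]
    rw [Fintype.piFinset_univ]
    refine (Fintype.sum_equiv (Equiv.curry α β Bool) _ _ ?_).symm
    intro d
    simp only [Equiv.curry_apply, Function.curry]
    rw [Fintype.prod_prod_type]
    split_ifs with h
    · exact Finset.prod_congr rfl fun a _ => by rw [if_pos]; exact h a
    · push Not at h
      obtain ⟨a, ha⟩ := h
      exact (Finset.prod_eq_zero (Finset.mem_univ a) (if_neg ha)).symm
  simp_rw [h1]
  rw [Finset.sum_comm]
  refine Finset.sum_congr rfl fun d _ => ?_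
  obtain ⟨a0⟩ := ‹Nonempty α›
  split_ifs with h
  · rw [hP] at h
    rw [Finset.sum_eq_single (cnt (fun b => d (a0, b)))]
    · rw [if_pos]; intro a; exact h a a0
    · intro k _ hk
      rw [if_neg]; intro h'; exact hk (h' a0).symm
    · intro hk
      exact absurd (Finset.mem_range.2 (Nat.lt_succ_of_le (cnt_le _))) hk
  · rw [hP] at h
    refine (Finset.sum_eq_zero fun k _ => if_neg ?_).symm
    intro h'; exact h fun a a' => (h' a).trans (h' a').symm

theorem cnt_comp {α β : Type*} [Fintype α] [Fintype β] (e : α ≃ β) (c : β → Bool) :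
    cnt (fun x => c (e x)) = cnt c := by
  classical
  unfold cnt
  refine Finset.card_bij (fun a _ => e a) ?_ ?_ ?_
  · simp
  · simp
  · intro b hb; exact ⟨e.symm b, by simpa using hb, by simp⟩

theorem cnt_prod {α β : Type*} [Fintype α] [Fintype β] (d : α × β → Bool) :
    cnt d = ∑ a, cnt (fun b => d (a, b)) := by
  unfold cnt
  simp only [Finset.card_filter]
  rw [Fintype.sum_prod_type]

theorem cnt_prod' {α β : Type*} [Fintype α] [Fintype β] (d : α × β → Bool) :
    cnt d = ∑ b, cnt (fun a => d (a, b)) := by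
  unfold cnt
  simp only [Finset.card_filter]
  rw [Fintype.sum_prod_type_right]

theorem cnt_zero {β : Type*} [Fintype β] (e : β → Bool) (h : cnt e = 0) : ∀ b, e b = false := by
  intro b
  simp only [cnt, Finset.card_eq_zero, Finset.filter_eq_empty_iff] at h
  simpa using h (Finset.mem_univ b)

theorem cnt_full {β : Type*} [Fintype β] (e : β → Bool) (h : cnt e = Fintype.card β) :
    ∀ b, e b = true := by
  intro b
  simp only [cnt, Finset.card_eq_iff_eq_univ, Finset.filter_eq_self] at h
  simpa using h b

theorem both {p r : ℕ} (hp : p.Prime) (hr : r.Prime) (hpr : p ≠ r) [NeZero p] [NeZero r]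
    (d : ZMod p × ZMod r → Bool)
    (hA : ∀ a a', cnt (fun b => d (a, b)) = cnt (fun b => d (a', b)))
    (hB : ∀ b b', cnt (fun a => d (a, b)) = cnt (fun a => d (a, b'))) :
    d = (fun _ => true) ∨ d = (fun _ => false) := by
  have h1 : cnt d = p * cnt (fun b => d (0, b)) := by
    rw [cnt_prod, Finset.sum_congr rfl fun a _ => hA a 0]; simp [ZMod.card]
  have h2 : cnt d = r * cnt (fun a => d (a, 0)) := by
    rw [cnt_prod', Finset.sum_congr rfl fun a _ => hB a 0]; simp [ZMod.card]
  have h3 : r ∣ cnt (fun b => d (0, b)) := by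
    have : r ∣ p * cnt (fun b => d (0, b)) := ⟨_, h1.symm.trans h2⟩
    exact (Nat.Coprime.dvd_of_dvd_mul_left ((Nat.coprime_primes hr hp).2 hpr.symm) this)
  obtain ⟨m, hm⟩ := h3
  have h4 : cnt (fun b => d (0, b)) ≤ r := by simpa [ZMod.card] using cnt_le (fun b => d (0, b))
  have h5 : m ≤ 1 := by
    have := hr.pos
    by_contra hc
    have : r * 2 ≤ r * m := Nat.mul_le_mul_left _ (by omega)
    omega
  interval_cases m
  · right
    funext x
    exact cnt_zero _ (by rw [h1, hm]; simp) x
  · left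
    funext x
    exact cnt_full _ (by rw [h1, hm]; simp [ZMod.card]) x

theorem det_zero_of_rows {p r : ℕ} (hp : p.Prime) [NeZero p] [NeZero r]
    (c : ZMod p × ZMod r → ℚ)
    (h : ∀ a a', ∑ b, c (a, b) = ∑ b, c (a', b)) :
    (Matrix.of fun x y : ZMod p × ZMod r => c (y - x)).det = 0 := by
  have := Fact.mk hp
  rw [← Matrix.exists_mulVec_eq_zero_iff]
  refine ⟨fun x => (if x.1 = 0 then 1 else 0) - (if x.1 = 1 then 1 else 0), ?_, ?_⟩
  · intro h0
    have := congrFun h0 (0, 0)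
    simp at this
  · funext x
    obtain ⟨x1, x2⟩ := x
    simp only [Matrix.mulVec, dotProduct, Matrix.of_apply, Pi.zero_apply]
    rw [Fintype.sum_prod_type]
    simp only [Prod.mk_sub_mk]
    have e : ∀ a, ∑ b, c (a, b - x2) = ∑ b, c (0, b) := fun a =>
      ((Equiv.subRight x2).sum_comp (fun b => c (a, b))).trans (h a 0)
    have e2 : ∀ a : ZMod p, ∑ b, c (a - x1, b - x2) *
        ((if a = 0 then (1 : ℚ) else 0) - if a = 1 then 1 else 0) =
        (∑ b, c (0, b)) * ((if a = 0 then (1 : ℚ) else 0) - if a = 1 then 1 else 0) := by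
      intro a
      rw [← e (a - x1), Finset.sum_mul]
    refine (Finset.sum_congr rfl fun a _ => e2 a).trans ?_
    simp [mul_sub, Finset.sum_sub_distrib]

theorem rows_of_det {p r : ℕ} (hp : p.Prime) (hr : r.Prime) (hpr : p ≠ r) [NeZero p] [NeZero r]
    (d : ZMod p × ZMod r → Bool)
    (h : (Matrix.of fun x y : ZMod p × ZMod r => if d (y - x) then (1 : ℚ) else 0).det = 0) :
    (∀ a a', ∑ b, (if d (a, b) then (1 : ℚ) else 0) = ∑ b, (if d (a', b) then (1 : ℚ) else 0)) ∨
    (∀ b b', ∑ a, (if d (a, b) then (1 : ℚ) else 0) = ∑ a, (if d (a, b') then (1 : ℚ) else 0)) := by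
  have hco : p.Coprime r := (Nat.coprime_primes hp hr).2 hpr
  have hp' := Fact.mk hp
  have hr' := Fact.mk hr
  have : NeZero (p * r) := ⟨(Nat.mul_pos hp.pos hr.pos).ne'⟩
  set c : ZMod p × ZMod r → ℚ := fun x => if d x then 1 else 0 with hc
  set ν : ZMod p × ZMod r → ℕ := fun z => ((ZMod.chineseRemainder hco).symm z).val with hν
  have hνz : ∀ z, ν z • (1 : ZMod p × ZMod r) = z := by
    intro z
    rw [nsmul_one]
    have : ((ν z : ℕ) : ZMod (p * r)) = (ZMod.chineseRemainder hco).symm z := by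
      simp [hν]
    have h2 := congrArg (ZMod.chineseRemainder hco) this
    rwa [map_natCast, RingEquiv.apply_symm_apply] at h2
  have hν1 : ∀ z, ((ν z : ℕ) : ZMod p) = z.1 := by
    intro z
    have := congrArg Prod.fst (hνz z)
    simpa using this
  have hν2 : ∀ z, ((ν z : ℕ) : ZMod r) = z.2 := by
    intro z
    have := congrArg Prod.snd (hνz z)
    simpa using this
  set f : Polynomial ℚ := ∑ z, Polynomial.C (c z) * Polynomial.X ^ (ν z) with hf
  set T := shiftOp (1 : ZMod p × ZMod r) with hT
  have hTn : T ^ (p * r) = 1 := by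
    refine LinearMap.ext fun w => funext fun x => ?_
    rw [hT, shiftOp_pow]
    have : (p * r) • (1 : ZMod p × ZMod r) = 0 := by
      ext <;> simp
    rw [this]; simp
  have hfT : ∀ w x, Polynomial.aeval T f w x = ∑ z, c z * w (x + z) := by
    intro w x
    rw [hf, hT, shiftOp_poly]
    simp_rw [hνz]
  have hXn : Polynomial.aeval T (Polynomial.X ^ (p * r) - 1 : Polynomial ℚ) = 0 := by
    rw [map_sub, map_pow, Polynomial.aeval_X, hTn, map_one, sub_self]
  -- not coprime
  have hnc : ¬ IsCoprime f (Polynomial.X ^ (p * r) - 1) := by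
    rintro ⟨u, v, huv⟩
    obtain ⟨w, hw0, hw⟩ := Matrix.exists_mulVec_eq_zero_iff.2 h
    have h0 : Polynomial.aeval T f w = 0 := by
      rw [← hw]
      funext x
      rw [hfT]
      simp only [Matrix.mulVec, dotProduct, Matrix.of_apply]
      refine Fintype.sum_equiv (Equiv.addLeft x) _ _ ?_
      intro z
      simp [hc]
    have h1 := congrArg (fun P => Polynomial.aeval T P w) huv
    simp only [map_add, map_mul, hXn, mul_zero, add_zero, Module.End.mul_apply, h0, map_zero,
      map_one, Module.End.one_apply] at h1
    exact hw0 h1.symm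
  rw [X_pow_pr hp hr hpr] at hnc
  simp only [IsCoprime.mul_right_iff] at hnc
  have irr : ∀ n, 0 < n → ¬ IsCoprime f (Polynomial.cyclotomic n ℚ) →
      Polynomial.cyclotomic n ℚ ∣ f := by
    intro n hn h
    by_contra hcon
    exact h (((Polynomial.cyclotomic.irreducible_rat hn).coprime_iff_not_dvd.2 hcon).symm)
  have cases4 : Polynomial.cyclotomic 1 ℚ ∣ f ∨ Polynomial.cyclotomic p ℚ ∣ f ∨
      Polynomial.cyclotomic r ℚ ∣ f ∨ Polynomial.cyclotomic (p * r) ℚ ∣ f := by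
    by_contra! hcon
    apply hnc
    rw [← Polynomial.cyclotomic_one]
    have := irr 1 one_pos
    have := irr p hp.pos
    have := irr r hr.pos
    have := irr (p * r) (Nat.mul_pos hp.pos hr.pos)
    tauto
  rcases cases4 with h1 | h1 | h1 | h1
  · left
    rw [Polynomial.cyclotomic_one, ← Polynomial.C_1, Polynomial.dvd_iff_isRoot, Polynomial.IsRoot, hf,
      Polynomial.eval_finsetSum] at h1
    simp only [Polynomial.eval_mul, Polynomial.eval_C, Polynomial.eval_pow, Polynomial.eval_X,
      one_pow, mul_one] at h1
    have h2 := (Finset.sum_eq_zero_iff_of_nonneg (fun z _ => by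
      simp only [hc]; split_ifs <;> norm_num)).1 h1
    intro a a'
    exact Finset.sum_congr rfl fun b _ => (h2 (a, b) (Finset.mem_univ _)).trans
      (h2 (a', b) (Finset.mem_univ _)).symm
  · left
    intro a a'
    have := rows_of_cyclotomic hp c ν h1 a a'
    simp_rw [hν1] at this
    simp [Fintype.sum_prod_type, Finset.sum_comm (s := (Finset.univ : Finset (ZMod p)))] at this
    exact this
  · right
    intro a a'
    have := rows_of_cyclotomic hr c ν h1 a a'
    simp_rw [hν2] at this
    simp [Fintype.sum_prod_type] at this
    exact this
  · have key : ∀ x, c (-(x + (p + r) • (1 : ZMod p × ZMod r))) - c (-(x + p • 1))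
        - c (-(x + r • 1)) + c (-x) = 0 := by
      intro x
      obtain ⟨g, hg⟩ := h1
      have e1 : (Polynomial.X ^ (p + r) - Polynomial.X ^ p - Polynomial.X ^ r + 1) * f =
          g * (Polynomial.X - 1) * (Polynomial.X ^ (p * r) - 1) := by
        have h2 := Polynomial.cyclotomic_prime_mul_X_sub_one ℚ r
        have h3 := Polynomial.cyclotomic_prime_mul_X_sub_one ℚ p
        rw [hg, X_pow_pr hp hr hpr]
        have : (Polynomial.X ^ (p + r) - Polynomial.X ^ p - Polynomial.X ^ r + 1 : Polynomial ℚ) =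
          (Polynomial.X ^ p - 1) * (Polynomial.X ^ r - 1) := by ring
        rw [this, ← h2, ← h3]; ring
      have e2 := congrFun (congrArg (fun P => Polynomial.aeval T P (Pi.single 0 1)) e1) x
      have hδ : ∀ x, Polynomial.aeval T f (Pi.single 0 1) x = c (-x) := by
        intro x
        rw [hfT, Finset.sum_eq_single (-x)]
        · simp
        · intro z _ hz
          rw [Pi.single_eq_of_ne, mul_zero]
          intro h; exact hz (eq_neg_of_add_eq_zero_right h)
        · simp
      rw [map_mul, map_mul _ _ (Polynomial.X ^ (p * r) - 1), hXn, mul_zero] at e2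
      simp only [map_add, map_sub, map_pow, Polynomial.aeval_X, map_one, Module.End.mul_apply,
        LinearMap.add_apply, LinearMap.sub_apply, Pi.add_apply, Pi.sub_apply,
        Module.End.one_apply, LinearMap.zero_apply, Pi.zero_apply] at e2
      rw [hT, shiftOp_pow, shiftOp_pow, shiftOp_pow, ← hT, hδ, hδ, hδ, hδ] at e2
      exact e2
    have k2 := aux_mixed hp hr hpr (fun x => c (-x)) key
    have k3 : ∀ a a' b b', c (a, b) - c (a, b') = c (a', b) - c (a', b') := by
      intro a a' b b'
      simpa using k2 (-a) (-a') (-b) (-b')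
    rcases mixed_bool d k3 with k | k
    · right
      intro b b'
      exact Finset.sum_congr rfl fun a _ => congrArg (fun t : Bool => if t then (1 : ℚ) else 0) (k a b b')
    · left
      intro a a'
      exact Finset.sum_congr rfl fun b _ => congrArg (fun t : Bool => if t then (1 : ℚ) else 0) (k a a' b)

theorem sum_eq_cnt {β : Type*} [Fintype β] (e : β → Bool) :
    ∑ b, (if e b then (1 : ℚ) else 0) = (cnt e : ℚ) := by
  simp [cnt]

theorem det_iff {p r : ℕ} (hp : p.Prime) (hr : r.Prime) (hpr : p ≠ r) [NeZero p] [NeZero r]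
    (d : ZMod p × ZMod r → Bool) :
    (Matrix.of fun x y : ZMod p × ZMod r => if d (y - x) then (1 : ℚ) else 0).det = 0 ↔
    (∀ a a', cnt (fun b => d (a, b)) = cnt (fun b => d (a', b))) ∨
    (∀ b b', cnt (fun a => d (a, b)) = cnt (fun a => d (a, b'))) := by
  constructor
  · intro h
    have := rows_of_det hp hr hpr d h
    rcases this with h | h
    · left
      intro a a'
      have h2 := h a a'
      rw [sum_eq_cnt (fun b => d (a, b)), sum_eq_cnt (fun b => d (a', b))] at h2
      exact_mod_cast h2
    · right
      intro a a'
      have h2 := h a a'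
      rw [sum_eq_cnt (fun b => d (b, a)), sum_eq_cnt (fun b => d (b, a'))] at h2
      exact_mod_cast h2
  · rintro (h | h)
    · refine det_zero_of_rows hp (fun x => if d x then (1 : ℚ) else 0) ?_
      intro a a'
      refine (sum_eq_cnt (fun b => d (a, b))).trans (Eq.trans ?_ (sum_eq_cnt (fun b => d (a', b))).symm)
      exact_mod_cast h a a'
    · have := det_zero_of_rows (p := r) (r := p) hr (fun x => if d x.swap then (1 : ℚ) else 0) (by
        intro a a'
        refine (sum_eq_cnt (fun b => d (b, a))).trans (Eq.trans ?_ (sum_eq_cnt (fun b => d (b, a'))).symm)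
        exact_mod_cast h a a')
      rw [← Matrix.det_submatrix_equiv_self (Equiv.prodComm _ _)] at this
      exact this

theorem Pq_eq {p r : ℕ} (hco : p.Coprime r) [NeZero p] [NeZero r] (q : ℝ) :
    Pq q (p * r) = ∑ d : ZMod p × ZMod r → Bool,
      if (Matrix.of fun x y : ZMod p × ZMod r => if d (y - x) then (1 : ℚ) else 0).det = 0 then
        ∏ x, wt q (d x) else 0 := by
  have : NeZero (p * r) := ⟨Nat.mul_ne_zero (NeZero.ne p) (NeZero.ne r)⟩
  let e : Fin (p * r) ≃ ZMod p × ZMod r :=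
    (ZMod.finEquiv (p * r)).toEquiv.trans (ZMod.chineseRemainder hco).toEquiv
  have he : ∀ i j, e (i - j) = e i - e j := by
    intro i j
    simp only [e, Equiv.trans_apply]
    change ZMod.chineseRemainder hco (ZMod.finEquiv (p * r) (i - j)) =
      ZMod.chineseRemainder hco (ZMod.finEquiv (p * r) i) - ZMod.chineseRemainder hco (ZMod.finEquiv (p * r) j)
    rw [← map_sub, ← map_sub]
  unfold Pq
  refine (Fintype.sum_equiv (Equiv.arrowCongr e.symm (Equiv.refl Bool)) _ _ ?_).symm
  intro d
  have h1 : ∀ i, (Equiv.arrowCongr e.symm (Equiv.refl Bool)) d i = d (e i) := fun i => rfl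
  have h2 : bernWeight q (p * r) ((Equiv.arrowCongr e.symm (Equiv.refl Bool)) d) =
      ∏ x, wt q (d x) := by
    rw [← e.prod_comp, prod_wt, Fintype.card_fin]
    rfl
  rw [h2]
  simp only [h1, he]
  rw [← Matrix.det_submatrix_equiv_self e]
  rfl


/-- Lemma 3.2 (3): for distinct primes p, r and q ∈ (0,1),
P_q(pr) = ∑_{k=0}^p φ_q(k,p)^r + ∑_{k=0}^r φ_q(k,r)^p − q^{pr} − (1-q)^{pr}. -/
theorem Pq_prime_mul (p r : ℕ) (hp : p.Prime) (hr : r.Prime) (hpr : p ≠ r)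
    (q : ℝ) (hq0 : 0 < q) (hq1 : q < 1) :
    Pq q (p * r) =
      (∑ k ∈ Finset.range (p + 1), phi q k p ^ r)
        + (∑ k ∈ Finset.range (r + 1), phi q k r ^ p)
        - q ^ (p * r) - (1 - q) ^ (p * r) := by
  have : NeZero p := ⟨hp.ne_zero⟩
  have : NeZero r := ⟨hr.ne_zero⟩
  have hp' := Fact.mk hp
  rw [Pq_eq ((Nat.coprime_primes hp hr).2 hpr)]
  have hdet := det_iff hp hr hpr
  obtain ⟨P, hP⟩ : ∃ P : (ZMod p × ZMod r → Bool) → Prop, ∀ d, P d ↔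
    ∀ a a', cnt (fun b => d (a, b)) = cnt (fun b => d (a', b)) := ⟨_, fun _ => Iff.rfl⟩
  obtain ⟨Q, hQ⟩ : ∃ Q : (ZMod p × ZMod r → Bool) → Prop, ∀ d, Q d ↔
    ∀ b b', cnt (fun a => d (a, b)) = cnt (fun a => d (a, b')) := ⟨_, fun _ => Iff.rfl⟩
  have decP : DecidablePred P := fun _ => Classical.propDecidable _
  have decQ : DecidablePred Q := fun _ => Classical.propDecidable _
  have hA := sum_rows (ZMod p) (ZMod r) q P hP
  have hB := sum_rows (ZMod r) (ZMod p) q (fun d => Q (fun x => d x.swap))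
    (fun d => hQ (fun x => d x.swap))
  rw [ZMod.card, ZMod.card] at hA hB
  have hB' : ∑ d : ZMod p × ZMod r → Bool,
      (if Q d then ∏ x, wt q (d x) else 0) = ∑ k ∈ Finset.range (p + 1), phi q k p ^ r := by
    rw [← hB]
    refine Fintype.sum_equiv (Equiv.arrowCongr (Equiv.prodComm _ _) (Equiv.refl Bool)) _ _ ?_
    intro d
    have : ∏ x, wt q (d x) = ∏ x : ZMod r × ZMod p, wt q (d x.swap) :=
      ((Equiv.prodComm (ZMod r) (ZMod p)).prod_comp (fun x => wt q (d x))).symm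
    rw [this]
    rfl
  have hAB : ∑ d : ZMod p × ZMod r → Bool,
      (if P d ∧ Q d then ∏ x, wt q (d x) else 0) = q ^ (p * r) + (1 - q) ^ (p * r) := by
    have hne : (fun _ => true : ZMod p × ZMod r → Bool) ≠ (fun _ => false) := by
      intro h; simpa using congrFun h 0
    rw [← Finset.sum_filter]
    have : (Finset.univ.filter fun d : ZMod p × ZMod r → Bool => P d ∧ Q d) =
        {(fun _ => true), (fun _ => false)} := by
      ext d
      simp only [Finset.mem_filter, Finset.mem_univ, true_and, Finset.mem_insert,
        Finset.mem_singleton, hP, hQ]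
      constructor
      · rintro ⟨h1, h2⟩
        exact both hp hr hpr d h1 h2
      · rintro (h | h) <;> subst h <;> exact ⟨fun _ _ => rfl, fun _ _ => rfl⟩
    rw [this, Finset.sum_pair hne]
    simp [wt, ZMod.card]
  have hsum : ∀ d : ZMod p × ZMod r → Bool,
      (if (Matrix.of fun x y : ZMod p × ZMod r => if d (y - x) then (1 : ℚ) else 0).det = 0 then
        ∏ x, wt q (d x) else 0) = (if P d then ∏ x, wt q (d x) else 0)
        + (if Q d then ∏ x, wt q (d x) else 0) - (if P d ∧ Q d then ∏ x, wt q (d x) else 0) := by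
    intro d
    have h := hdet d
    rw [← hP, ← hQ] at h
    rw [if_congr h rfl rfl]
    by_cases h1 : P d <;> by_cases h2 : Q d <;> simp [h1, h2]
  rw [Finset.sum_congr rfl fun d _ => hsum d, Finset.sum_sub_distrib, Finset.sum_add_distrib,
    hA, hB', hAB]
  ring
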